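/- Assume Σ_{x∈ℤ}(|α(x)−α₀| + |θ(x)|) < ∞ and let ξ ∈ ℝ with sin ξ ≠ 0. Then any Jost solutions φ₊(·,ξ) and φ₋(·,ξ) are linearly independent; equivalently, the Wronskian W_ξ := det(φ₊(x,ξ) | φ₋(x,ξ)) (which is independent of x) is nonzero. -/

import Mathlib

open Complex Matrix

noncomputable section

/-- The coin matrix `C_{α,β,θ} = e^{iθ}[[β, conj α],[−α, conj β]]`. -/
def coinMat (a b : ℂ) (t : ℝ) : Matrix (Fin 2) (Fin 2) ℂ :=
  Complex.exp ((t : ℂ) * Complex.I) • !![b, (starRingEnd ℂ) a; -a, (starRingEnd ℂ) b]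

/-- The quantum walk evolution operator `U = SĈ`, acting on arbitrary `u : ℤ → ℂ²`:
`(Uu)↑(x) = (C(x−1)u(x−1))↑`, `(Uu)↓(x) = (C(x+1)u(x+1))↓`. -/
def qw (C : ℤ → Matrix (Fin 2) (Fin 2) ℂ) (u : ℤ → Fin 2 → ℂ) : ℤ → Fin 2 → ℂ :=
  fun x => ![(C (x - 1)).mulVec (u (x - 1)) 0, (C (x + 1)).mulVec (u (x + 1)) 1]

/-- `ρ = √(1−|a|²)`. -/
def rho (a : ℂ) : ℝ := Real.sqrt (1 - ‖a‖ ^ 2)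

/-- The coin map `x ↦ C_{α(x), ρ(x), θ(x)}`. -/
def coinOf (α : ℤ → ℂ) (θ : ℤ → ℝ) : ℤ → Matrix (Fin 2) (Fin 2) ℂ :=
  fun x => coinMat (α x) ((rho (α x) : ℝ) : ℂ) (θ x)

/-- The transfer matrix `T_λ(x)`. -/
def Tmat (α : ℤ → ℂ) (θ : ℤ → ℝ) (lam : ℂ) (x : ℤ) : Matrix (Fin 2) (Fin 2) ℂ :=
  (((rho (α x) : ℝ) : ℂ))⁻¹ •
    !![Complex.exp (Complex.I * (lam - (θ x : ℂ))), α x;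
       (starRingEnd ℂ) (α x), Complex.exp (-(Complex.I * (lam - (θ x : ℂ))))]

/-- `(J_VE u)(x) = (u↓(x−1), u↑(x))`. -/
def Jve (u : ℤ → Fin 2 → ℂ) : ℤ → Fin 2 → ℂ := fun x => ![u (x - 1) 1, u x 0]

/-- `(J_EV v)(x) = (v↓(x), v↑(x+1))`, the inverse of `J_VE`. -/
def Jev (v : ℤ → Fin 2 → ℂ) : ℤ → Fin 2 → ℂ := fun x => ![v x 1, v (x + 1) 0]

/-- Determinant of the 2×2 matrix with columns `v, w`. -/
def det2 (v w : Fin 2 → ℂ) : ℂ := v 0 * w 1 - v 1 * w 0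

/-- The Euclidean norm on ℂ². -/
def nrm2 (v : Fin 2 → ℂ) : ℝ := Real.sqrt (‖v 0‖ ^ 2 + ‖v 1‖ ^ 2)

/-- Membership in `l²(ℤ, ℂ²)`. -/
def MemL2 (u : ℤ → Fin 2 → ℂ) : Prop := Summable fun x : ℤ => ‖u x 0‖ ^ 2 + ‖u x 1‖ ^ 2

/-- The Japanese bracket `⟨x⟩ = √(1+x²)`. -/
def jp (x : ℤ) : ℝ := Real.sqrt (1 + (x : ℝ) ^ 2)

/-- The free transfer matrix `T_{0,λ}` (for real `λ`). -/
def T0m (a0 : ℂ) (lam : ℝ) : Matrix (Fin 2) (Fin 2) ℂ :=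
  (((rho a0 : ℝ) : ℂ))⁻¹ •
    !![Complex.exp (Complex.I * (lam : ℂ)), a0;
       (starRingEnd ℂ) a0, Complex.exp (-(Complex.I * (lam : ℂ)))]

/-- `λ(ξ) = arccos(ρ₀ cos ξ) ∈ [0,π]`. -/
def lamOf (a0 : ℂ) (ξ : ℝ) : ℝ := Real.arccos (rho a0 * Real.cos ξ)

/-- `A_{ξ,±} = e^{∓iξ}T_{0,λ(ξ)}`; `ε = 1` is the `+` case, `ε = −1` the `−` case. -/
def Amat (a0 : ℂ) (ε : ℝ) (ξ : ℝ) : Matrix (Fin 2) (Fin 2) ℂ :=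
  Complex.exp (-(((ε * ξ : ℝ) : ℂ) * Complex.I)) • T0m a0 (lamOf a0 ξ)

/-- Integer powers of a matrix: for negative exponents, powers of the inverse matrix. -/
def mzpow (A : Matrix (Fin 2) (Fin 2) ℂ) (x : ℤ) : Matrix (Fin 2) (Fin 2) ℂ :=
  if 0 ≤ x then A ^ x.toNat else A⁻¹ ^ (-x).toNat

/-- The operator norm on `ℂ²` of a 2×2 matrix. -/
def opN (A : Matrix (Fin 2) (Fin 2) ℂ) : ℝ := ‖Matrix.toEuclideanCLM (𝕜 := ℂ) A‖

/-- `A_±(ξ) = |α₀|² + |e^{iλ(ξ)} − ρ₀e^{±iξ}|²`; `ε = ±1`. -/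
def Aco (a0 : ℂ) (ε : ℝ) (ξ : ℝ) : ℝ :=
  ‖a0‖ ^ 2 + ‖Complex.exp (Complex.I * (lamOf a0 ξ : ℂ))
      - ((rho a0 : ℝ) : ℂ) * Complex.exp (((ε * ξ : ℝ) : ℂ) * Complex.I)‖ ^ 2

/-- The unit eigenvector `φ_±(ξ) = A_±(ξ)^{−1/2}(−α₀, e^{iλ(ξ)} − ρ₀e^{±iξ})ᵀ`; `ε = ±1`. -/
def jvec (a0 : ℂ) (ε : ℝ) (ξ : ℝ) : Fin 2 → ℂ :=
  (((Real.sqrt (Aco a0 ε ξ))⁻¹ : ℝ) : ℂ) •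
    ![-a0, Complex.exp (Complex.I * (lamOf a0 ξ : ℂ))
        - ((rho a0 : ℝ) : ℂ) * Complex.exp (((ε * ξ : ℝ) : ℂ) * Complex.I)]

/-- `φ` is a Jost solution `φ₊(·,ξ)`: solves the transfer recursion at `λ(ξ)` and
`e^{−iξx}φ(x) → φ₊(ξ)` as `x → +∞`. -/
def IsJostP (α : ℤ → ℂ) (θ : ℤ → ℝ) (a0 : ℂ) (ξ : ℝ) (φ : ℤ → Fin 2 → ℂ) : Prop :=
  (∀ x : ℤ, φ (x + 1) = (Tmat α θ ((lamOf a0 ξ : ℝ) : ℂ) x).mulVec (φ x)) ∧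
  Filter.Tendsto
    (fun x : ℤ => fun i : Fin 2 => Complex.exp (-(((ξ * x : ℝ) : ℂ) * Complex.I)) * φ x i)
    Filter.atTop (nhds (jvec a0 1 ξ))

/-- `φ` is a Jost solution `φ₋(·,ξ)`: solves the transfer recursion at `λ(ξ)` and
`e^{iξx}φ(x) → φ₋(ξ)` as `x → −∞`. -/
def IsJostM (α : ℤ → ℂ) (θ : ℤ → ℝ) (a0 : ℂ) (ξ : ℝ) (φ : ℤ → Fin 2 → ℂ) : Prop :=
  (∀ x : ℤ, φ (x + 1) = (Tmat α θ ((lamOf a0 ξ : ℝ) : ℂ) x).mulVec (φ x)) ∧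
  Filter.Tendsto
    (fun x : ℤ => fun i : Fin 2 => Complex.exp (((ξ * x : ℝ) : ℂ) * Complex.I) * φ x i)
    Filter.atBot (nhds (jvec a0 (-1) ξ))

/-- The indefinite form `|v↑|² − |v↓|²` preserved by `SU(1,1)`. -/
def krein (v : Fin 2 → ℂ) : ℝ := ‖v 0‖ ^ 2 - ‖v 1‖ ^ 2

lemma continuous_krein : Continuous krein := by
  unfold krein
  fun_prop

lemma krein_smul (c : ℂ) (v : Fin 2 → ℂ) : krein (c • v) = ‖c‖ ^ 2 * krein v := by
  simp only [krein, Pi.smul_apply, smul_eq_mul, norm_mul]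
  ring

lemma rho_sq {a : ℂ} (ha : ‖a‖ < 1) : rho a ^ 2 = 1 - ‖a‖ ^ 2 :=
  Real.sq_sqrt (by nlinarith [norm_nonneg a])

lemma rho_pos {a : ℂ} (ha : ‖a‖ < 1) : 0 < rho a :=
  Real.sqrt_pos.2 (by nlinarith [norm_nonneg a])

lemma krein_eq_mul_conj (v : Fin 2 → ℂ) :
    (krein v : ℂ) = v 0 * (starRingEnd ℂ) (v 0) - v 1 * (starRingEnd ℂ) (v 1) := by
  simp [krein, Complex.mul_conj, Complex.normSq_eq_norm_sq]

lemma krein_Tmat_mulVec {α : ℤ → ℂ} (θ : ℤ → ℝ) (lam : ℝ) {x : ℤ} (hx : ‖α x‖ < 1)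
    (v : Fin 2 → ℂ) : krein ((Tmat α θ (lam : ℂ) x).mulVec v) = krein v := by
  have hr : ((rho (α x) : ℝ) : ℂ) ≠ 0 := by exact_mod_cast (rho_pos hx).ne'
  have hr2 : ((rho (α x) : ℝ) : ℂ) ^ 2 = 1 - α x * (starRingEnd ℂ) (α x) := by
    rw [Complex.mul_conj, Complex.normSq_eq_norm_sq]
    exact_mod_cast rho_sq hx
  have hconj : (starRingEnd ℂ) (Complex.exp (Complex.I * ((lam : ℂ) - (θ x : ℂ)))) =
      Complex.exp (-(Complex.I * ((lam : ℂ) - (θ x : ℂ)))) := by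
    rw [← Complex.exp_conj]
    simp
  have hconj' : (starRingEnd ℂ) (Complex.exp (-(Complex.I * ((lam : ℂ) - (θ x : ℂ))))) =
      Complex.exp (Complex.I * ((lam : ℂ) - (θ x : ℂ))) := by
    rw [← hconj, Complex.conj_conj]
  have hee : Complex.exp (Complex.I * ((lam : ℂ) - (θ x : ℂ))) *
      Complex.exp (-(Complex.I * ((lam : ℂ) - (θ x : ℂ)))) = 1 := by
    rw [← Complex.exp_add, add_neg_cancel, Complex.exp_zero]
  apply Complex.ofReal_injective
  rw [krein_eq_mul_conj, krein_eq_mul_conj]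
  simp only [Tmat, Matrix.mulVec, dotProduct, Fin.sum_univ_two,
    Matrix.smul_apply, smul_eq_mul, Matrix.of_apply, Matrix.cons_val_zero, Matrix.cons_val_one,
    map_mul, map_add, map_inv₀, Complex.conj_ofReal, Complex.conj_conj, hconj, hconj']
  generalize Complex.exp (Complex.I * ((lam : ℂ) - (θ x : ℂ))) = e at *
  generalize Complex.exp (-(Complex.I * ((lam : ℂ) - (θ x : ℂ)))) = e' at *
  field_simp
  rw [hr2]
  linear_combination
    (v 0 * (starRingEnd ℂ) (v 0) - v 1 * (starRingEnd ℂ) (v 1)) * hee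

lemma krein_eq_of_recursion {α : ℤ → ℂ} {θ : ℤ → ℝ} {lam : ℝ} (hα : ∀ x, ‖α x‖ < 1)
    {φ : ℤ → Fin 2 → ℂ} (hφ : ∀ x : ℤ, φ (x + 1) = (Tmat α θ (lam : ℂ) x).mulVec (φ x))
    (x y : ℤ) : krein (φ x) = krein (φ y) := by
  have hper : Function.Periodic (fun x => krein (φ x)) 1 := fun x => by
    simp only [hφ, krein_Tmat_mulVec θ lam (hα x)]
  simpa using (hper.sub_zsmul_eq (x - y) (x := x)).symm

lemma krein_eq_of_tendsto {α : ℤ → ℂ} {θ : ℤ → ℝ} {lam : ℝ} (hα : ∀ x, ‖α x‖ < 1)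
    {φ : ℤ → Fin 2 → ℂ} (hφ : ∀ x : ℤ, φ (x + 1) = (Tmat α θ (lam : ℂ) x).mulVec (φ x))
    {l : Filter ℤ} [l.NeBot] {c : ℤ → ℂ} (hc : ∀ x, ‖c x‖ = 1) {v : Fin 2 → ℂ}
    (hv : Filter.Tendsto (fun x => c x • φ x) l (nhds v)) (x : ℤ) : krein (φ x) = krein v := by
  refine tendsto_nhds_unique ?_ ((continuous_krein.tendsto v).comp hv)
  refine tendsto_const_nhds.congr fun y => ?_
  rw [Function.comp_apply, krein_smul, hc, one_pow, one_mul]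
  exact krein_eq_of_recursion hα hφ x y

lemma cos_lamOf {a : ℂ} (ha : ‖a‖ < 1) (ξ : ℝ) :
    Real.cos (lamOf a ξ) = rho a * Real.cos ξ := by
  have h : |rho a * Real.cos ξ| ≤ 1 := by
    rw [abs_mul]
    refine mul_le_one₀ ?_ (abs_nonneg _) (Real.abs_cos_le_one ξ)
    rw [abs_of_pos (rho_pos ha)]
    nlinarith [rho_sq ha, rho_pos ha, sq_nonneg ‖a‖]
  exact Real.cos_arccos (abs_le.1 h).1 (abs_le.1 h).2

lemma abs_rho_mul_sin_lt_sin_lamOf {a : ℂ} (h₀ : 0 < ‖a‖) (h₁ : ‖a‖ < 1) (ξ : ℝ) :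
    |rho a * Real.sin ξ| < Real.sin (lamOf a ξ) := by
  refine abs_lt_of_sq_lt_sq ?_
    (Real.sin_nonneg_of_nonneg_of_le_pi (Real.arccos_nonneg _) (Real.arccos_le_pi _))
  rw [Real.sin_sq (lamOf a ξ), cos_lamOf h₁, mul_pow, mul_pow, rho_sq h₁, Real.cos_sq' ξ]
  nlinarith [pow_pos h₀ 2]

lemma norm_exp_lamOf_sub_sq {a : ℂ} (ha : ‖a‖ < 1) {ε : ℝ} (hε : ε = 1 ∨ ε = -1) (ξ : ℝ) :
    ‖Complex.exp (Complex.I * (lamOf a ξ : ℂ))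
      - ((rho a : ℝ) : ℂ) * Complex.exp (((ε * ξ : ℝ) : ℂ) * Complex.I)‖ ^ 2 =
      (Real.sin (lamOf a ξ) - ε * (rho a * Real.sin ξ)) ^ 2 := by
  have hcos : Real.cos (ε * ξ) = Real.cos ξ := by rcases hε with rfl | rfl <;> simp
  have hsin : Real.sin (ε * ξ) = ε * Real.sin ξ := by rcases hε with rfl | rfl <;> simp
  rw [← Complex.normSq_eq_norm_sq, Complex.normSq_apply, mul_comm Complex.I]
  simp only [Complex.sub_re, Complex.sub_im, Complex.re_ofReal_mul, Complex.im_ofReal_mul,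
    Complex.exp_ofReal_mul_I_re, Complex.exp_ofReal_mul_I_im, cos_lamOf ha, hcos, hsin]
  ring

/-- The eigenvector `φ_±(ξ)` has `krein`-sign equal to the sign of `± sin ξ`. -/
lemma krein_jvec_mul_sin_pos {a : ℂ} (h₀ : 0 < ‖a‖) (h₁ : ‖a‖ < 1) {ε : ℝ}
    (hε : ε = 1 ∨ ε = -1) {ξ : ℝ} (hξ : Real.sin ξ ≠ 0) :
    0 < krein (jvec a ε ξ) * (ε * Real.sin ξ) := by
  have hA : 0 < Aco a ε ξ := by unfold Aco; positivity
  have hlt := abs_lt.1 (abs_rho_mul_sin_lt_sin_lamOf h₀ h₁ ξ)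
  have hpos : 0 < Real.sin (lamOf a ξ) - ε * (rho a * Real.sin ξ) := by
    rcases hε with rfl | rfl <;> linarith
  have hε2 : ε ^ 2 = 1 := by rcases hε with rfl | rfl <;> norm_num
  have hsq : Real.sin (lamOf a ξ) ^ 2 = ‖a‖ ^ 2 + (rho a * Real.sin ξ) ^ 2 := by
    rw [Real.sin_sq (lamOf a ξ), cos_lamOf h₁, mul_pow, mul_pow, rho_sq h₁, Real.cos_sq' ξ]
    ring
  have hform : krein (jvec a ε ξ) * (ε * Real.sin ξ) = (Real.sqrt (Aco a ε ξ))⁻¹ ^ 2 *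
      (2 * rho a * Real.sin ξ ^ 2 * (Real.sin (lamOf a ξ) - ε * (rho a * Real.sin ξ))) := by
    rw [jvec, krein_smul, Complex.norm_real, Real.norm_eq_abs, sq_abs, krein]
    simp only [Matrix.cons_val_zero, Matrix.cons_val_one, norm_neg,
      norm_exp_lamOf_sub_sq h₁ hε]
    linear_combination (Real.sqrt (Aco a ε ξ))⁻¹ ^ 2 *
      (2 * rho a * Real.sin ξ ^ 2 * Real.sin (lamOf a ξ) * hε2 - ε * Real.sin ξ * hsq
        - ε * rho a ^ 2 * Real.sin ξ ^ 3 * hε2)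
  rw [hform]
  have := rho_pos h₁
  have := Real.sqrt_pos.2 hA
  have := pow_pos (abs_pos.2 hξ) 2
  rw [sq_abs] at this
  positivity

lemma det2_ne_zero_of_krein_mul_neg {v w : Fin 2 → ℂ} (h : krein v * krein w < 0) :
    det2 v w ≠ 0 := by
  intro hdet
  have hn : ‖v 0‖ * ‖w 1‖ = ‖v 1‖ * ‖w 0‖ := by
    rw [← norm_mul, ← norm_mul, sub_eq_zero.1 hdet]
  have hn2 : ‖v 0‖ ^ 2 * ‖w 1‖ ^ 2 = ‖v 1‖ ^ 2 * ‖w 0‖ ^ 2 := by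
    rw [← mul_pow, hn, mul_pow]
  unfold krein at h
  rcases mul_neg_iff.1 h with ⟨hv, hw⟩ | ⟨hv, hw⟩ <;>
    nlinarith [sq_nonneg ‖v 0‖, sq_nonneg ‖v 1‖, sq_nonneg ‖w 0‖, sq_nonneg ‖w 1‖]

/-- for `sin ξ ≠ 0` the Jost solutions `φ₊(·,ξ)`, `φ₋(·,ξ)` are linearly
independent: their Wronskian is nonzero (at every `x`). -/
theorem stmt15 (α₀ : ℂ) (h₀ : 0 < ‖α₀‖) (h₁ : ‖α₀‖ < 1)
    (α : ℤ → ℂ) (θ : ℤ → ℝ) (hα : ∀ x : ℤ, ‖α x‖ < 1)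
    (hsum : Summable fun x : ℤ => ‖α x - α₀‖ + |θ x|)
    (ξ : ℝ) (hξ : Real.sin ξ ≠ 0)
    (φp φm : ℤ → Fin 2 → ℂ)
    (hp : IsJostP α θ α₀ ξ φp) (hm : IsJostM α θ α₀ ξ φm) :
    ∀ x : ℤ, det2 (φp x) (φm x) ≠ 0 := by
  intro x
  have hkp : krein (φp x) = krein (jvec α₀ 1 ξ) :=
    krein_eq_of_tendsto hα hp.1
      (fun y => by rw [← neg_mul, ← Complex.ofReal_neg, Complex.norm_exp_ofReal_mul_I]) hp.2 x
  have hkm : krein (φm x) = krein (jvec α₀ (-1) ξ) :=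
    krein_eq_of_tendsto hα hm.1 (fun y => Complex.norm_exp_ofReal_mul_I _) hm.2 x
  have hposp := krein_jvec_mul_sin_pos h₀ h₁ (.inl rfl) hξ
  have hposm := krein_jvec_mul_sin_pos h₀ h₁ (.inr rfl) hξ
  apply det2_ne_zero_of_krein_mul_neg
  rw [hkp, hkm]
  have := mul_pos hposp hposm
  by_contra! hge
  nlinarith [mul_nonneg hge (sq_nonneg (Real.sin ξ))]
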